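/- Let u, v, a ≥ 2, let α : Fin u → Fin v → Fin a → ℝ have all one-dimensional fiber sums equal to zero along each of the three axes, and let δ be the difference between the largest and the smallest entry of α. Let n ≥ 1 be real, σ² > 0, let m₁ ≤ m₂ ≤ m₃ be the values a, u, v sorted from least to greatest, and define λ = n·(∑_{k,j,i} α_{k,j,i}²)/σ². Then λ ≥ (n/2) · (δ²/σ²) · m₂ m₃ / ((m₂−1)(m₃−1)). -/

import Mathlib

theorem perm_cases (m₁ m₂ m₃ a u v : ℕ)
    (h : ({m₁, m₂, m₃} : Multiset ℕ) = {a, u, v}) :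
    (a = m₁ ∧ u = m₂ ∧ v = m₃) ∨ (a = m₁ ∧ u = m₃ ∧ v = m₂) ∨
    (a = m₂ ∧ u = m₁ ∧ v = m₃) ∨ (a = m₂ ∧ u = m₃ ∧ v = m₁) ∨
    (a = m₃ ∧ u = m₁ ∧ v = m₂) ∨ (a = m₃ ∧ u = m₂ ∧ v = m₁) := by
  have h' : [a, u, v].Perm [m₁, m₂, m₃] := (Multiset.coe_eq_coe.mp h).symm
  have := List.mem_permutations.mpr h'
  simp [List.permutations, List.permutationsAux, List.permutationsAux.rec,
    List.permutationsAux2] at this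
  tauto

/-- centred indicator -/
noncomputable def cInd {N : ℕ} (p : Fin N) (k : Fin N) : ℝ := (if k = p then 1 else 0) - 1 / (N : ℝ)

theorem cInd_mul {N : ℕ} (p : Fin N) (f : Fin N → ℝ) (hf : ∑ k, f k = 0) :
    ∑ k, cInd p k * f k = f p := by
  simp [cInd, sub_mul, Finset.sum_sub_distrib, ← Finset.mul_sum, hf]

theorem cInd_sum {N : ℕ} (p : Fin N) : ∑ k, cInd p k = 0 := by
  have : (N : ℝ) ≠ 0 := by
    have := p.pos
    positivity
  simp [cInd, Finset.sum_sub_distrib, this]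

theorem triple_prod {u v a : ℕ} (A A' : Fin u → ℝ) (B B' : Fin v → ℝ) (C C' : Fin a → ℝ) :
    ∑ k, ∑ j, ∑ i, (A k * B j * C i) * (A' k * B' j * C' i) =
      (∑ k, A k * A' k) * (∑ j, B j * B' j) * (∑ i, C i * C' i) := by
  rw [Finset.sum_mul_sum, Finset.sum_mul]
  refine Finset.sum_congr rfl fun k _ => ?_
  rw [Finset.sum_mul]
  refine Finset.sum_congr rfl fun j _ => ?_
  rw [Finset.mul_sum]
  refine Finset.sum_congr rfl fun i _ => ?_
  ring

theorem triple_eval {u v a : ℕ} (α : Fin u → Fin v → Fin a → ℝ)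
    (h1 : ∀ k j, ∑ i, α k j i = 0)
    (h2 : ∀ k i, ∑ j, α k j i = 0)
    (h3 : ∀ j i, ∑ k, α k j i = 0) (p : Fin u) (q : Fin v) (r : Fin a) :
    ∑ k, ∑ j, ∑ i, (cInd p k * cInd q j * cInd r i) * α k j i = α p q r := by
  have e : ∀ k j, ∑ i, (cInd p k * cInd q j * cInd r i) * α k j i
      = cInd p k * (cInd q j * α k j r) := by
    intro k j
    rw [← cInd_mul r (α k j) (h1 k j), Finset.mul_sum, Finset.mul_sum]
    refine Finset.sum_congr rfl fun i _ => ?_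
    ring
  simp_rw [e, ← Finset.mul_sum]
  have e2 : ∀ k, ∑ j, cInd q j * α k j r = α k q r := fun k =>
    cInd_mul q (fun j => α k j r) (h2 k r)
  simp_rw [e2]
  exact cInd_mul p (fun k => α k q r) (h3 q r)

theorem arith (x y z P Q R M : ℝ) (hx0 : 0 ≤ x) (hy0 : 0 ≤ y) (hz0 : 0 ≤ z)
    (hx : x ≤ 1 / 2) (hy : y ≤ 1 / 2) (hz : z ≤ 1 / 2)
    (hP : P = 1 - x ∨ P = -x) (hQ : Q = 1 - y ∨ Q = -y) (hR : R = 1 - z ∨ R = -z)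
    (hxy : (1 - x) * (1 - y) ≤ M) (hxz : (1 - x) * (1 - z) ≤ M) (hyz : (1 - y) * (1 - z) ≤ M) :
    (1 - x) * (1 - y) * (1 - z) - P * Q * R ≤ M := by
  have X : 0 ≤ 1 - x := by linarith
  have Y : 0 ≤ 1 - y := by linarith
  have Z : 0 ≤ 1 - z := by linarith
  have hYZ : 0 ≤ (1 - y) * (1 - z) := by positivity
  have hM : (1 - x) * (1 - y) * (1 - z) ≤ M := by
    nlinarith [mul_nonneg hx0 hYZ]
  rcases hP with rfl | rfl <;> rcases hQ with rfl | rfl <;> rcases hR with rfl | rfl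
  · nlinarith
  · nlinarith
  · nlinarith
  · have : 0 ≤ (1 - x) * (y * z) := by positivity
    nlinarith
  · nlinarith
  · have : 0 ≤ x * ((1 - y) * z) := by positivity
    nlinarith
  · have : 0 ≤ x * (y * (1 - z)) := by positivity
    nlinarith
  · have h : y * z ≤ (1 - y) * (1 - z) := by nlinarith
    have := mul_le_mul_of_nonneg_left h hx0
    nlinarith

theorem cInd_self {N : ℕ} (p : Fin N) : ∑ k, cInd p k * cInd p k = 1 - 1 / (N : ℝ) := by
  rw [cInd_mul p _ (cInd_sum p)]; simp [cInd]

theorem cInd_cross {N : ℕ} (p q : Fin N) : ∑ k, cInd p k * cInd q k = 1 - 1 / (N : ℝ) ∨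
    ∑ k, cInd p k * cInd q k = - (1 / (N : ℝ)) := by
  rw [cInd_mul p _ (cInd_sum q)]
  by_cases h : p = q <;> simp [cInd, h]

theorem inv_bd {N : ℕ} (h : 2 ≤ N) : 0 ≤ 1 / (N : ℝ) ∧ 1 / (N : ℝ) ≤ 1 / 2 := by
  refine ⟨by positivity, ?_⟩
  have : (2 : ℝ) ≤ N := by exact_mod_cast h
  exact one_div_le_one_div_of_le (by norm_num) this

theorem main_bd {u v a : ℕ} (hu : 2 ≤ u) (hv : 2 ≤ v) (ha : 2 ≤ a)
    (α : Fin u → Fin v → Fin a → ℝ)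
    (h1 : ∀ k j, ∑ i, α k j i = 0)
    (h2 : ∀ k i, ∑ j, α k j i = 0)
    (h3 : ∀ j i, ∑ k, α k j i = 0) (p p' : Fin u × Fin v × Fin a) (M : ℝ)
    (hxy : (1 - 1 / (u : ℝ)) * (1 - 1 / (v : ℝ)) ≤ M)
    (hxz : (1 - 1 / (u : ℝ)) * (1 - 1 / (a : ℝ)) ≤ M)
    (hyz : (1 - 1 / (v : ℝ)) * (1 - 1 / (a : ℝ)) ≤ M) :
    (α p.1 p.2.1 p.2.2 - α p'.1 p'.2.1 p'.2.2) ^ 2 ≤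
      2 * M * ∑ k, ∑ j, ∑ i, (α k j i) ^ 2 := by
  obtain ⟨p, q, r⟩ := p
  obtain ⟨p', q', r'⟩ := p'
  have key := arith _ _ _ _ _ _ M (inv_bd hu).1 (inv_bd hv).1 (inv_bd ha).1
    (inv_bd hu).2 (inv_bd hv).2 (inv_bd ha).2
    (cInd_cross p p') (cInd_cross q q') (cInd_cross r r') hxy hxz hyz
  let W : Fin u → Fin v → Fin a → ℝ := fun k j i =>
    cInd p k * cInd q j * cInd r i - cInd p' k * cInd q' j * cInd r' i
  have hW : ∑ k, ∑ j, ∑ i, (W k j i) ^ 2 ≤ 2 * M := by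
    have e : ∀ k j i, (W k j i) ^ 2 =
        (cInd p k * cInd q j * cInd r i) * (cInd p k * cInd q j * cInd r i)
        + (cInd p' k * cInd q' j * cInd r' i) * (cInd p' k * cInd q' j * cInd r' i)
        - 2 * ((cInd p k * cInd q j * cInd r i) * (cInd p' k * cInd q' j * cInd r' i)) := by
      intro k j i
      simp only [W]; ring
    simp_rw [e, Finset.sum_sub_distrib, Finset.sum_add_distrib, ← Finset.mul_sum, triple_prod,
      cInd_self]
    linarith
  have hE : ∑ k, ∑ j, ∑ i, W k j i * α k j i = α p q r - α p' q' r' := by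
    rw [← triple_eval α h1 h2 h3 p q r, ← triple_eval α h1 h2 h3 p' q' r']
    simp_rw [W, sub_mul, Finset.sum_sub_distrib]
  have cs := Finset.sum_mul_sq_le_sq_mul_sq (Finset.univ : Finset (Fin u × Fin v × Fin a))
    (fun t => W t.1 t.2.1 t.2.2) (fun t => α t.1 t.2.1 t.2.2)
  simp only [Fintype.sum_prod_type] at cs
  rw [hE] at cs
  refine cs.trans (mul_le_mul_of_nonneg_right hW ?_)
  exact Finset.sum_nonneg fun k _ => Finset.sum_nonneg fun j _ => Finset.sum_nonneg fun i _ =>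
    sq_nonneg _

theorem mono_bd {b c d e : ℕ} (hb : 2 ≤ b) (hc : 2 ≤ c) (h : b ≤ d) (h' : c ≤ e) :
    (1 - 1 / (b : ℝ)) * (1 - 1 / (c : ℝ)) ≤ (1 - 1 / (d : ℝ)) * (1 - 1 / (e : ℝ)) := by
  have hb' : (0 : ℝ) < b := by positivity
  have hc' : (0 : ℝ) < c := by positivity
  have i1 : 1 / (d : ℝ) ≤ 1 / b := one_div_le_one_div_of_le hb' (by exact_mod_cast h)
  have i2 : 1 / (e : ℝ) ≤ 1 / c := one_div_le_one_div_of_le hc' (by exact_mod_cast h')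
  have := inv_bd hb
  have := inv_bd hc
  exact mul_le_mul (by linarith) (by linarith) (by linarith) (by linarith)

/-- Least favorable case bound for the noncentrality parameter of the exact
F-test in the balanced three-way nested model `U ≻ V ≻ A` with fixed `A`, where
`m₁ ≤ m₂ ≤ m₃` are `a, u, v` sorted from least to greatest. -/
theorem stmt_7 (u v a : ℕ) (hu : 2 ≤ u) (hv : 2 ≤ v) (ha : 2 ≤ a)
    (α : Fin u → Fin v → Fin a → ℝ)
    (h1 : ∀ k j, ∑ i, α k j i = 0)
    (h2 : ∀ k i, ∑ j, α k j i = 0)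
    (h3 : ∀ j i, ∑ k, α k j i = 0)
    (δ : ℝ)
    (hδ : δ = Finset.univ.sup'
          (Finset.univ_nonempty_iff.mpr ⟨(⟨0, by omega⟩, ⟨0, by omega⟩, ⟨0, by omega⟩)⟩)
          (fun p : Fin u × Fin v × Fin a => α p.1 p.2.1 p.2.2)
        - Finset.univ.inf'
          (Finset.univ_nonempty_iff.mpr ⟨(⟨0, by omega⟩, ⟨0, by omega⟩, ⟨0, by omega⟩)⟩)
          (fun p : Fin u × Fin v × Fin a => α p.1 p.2.1 p.2.2))
    (n σ2 : ℝ) (hn : 1 ≤ n) (hσ : 0 < σ2)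
    (m₁ m₂ m₃ : ℕ) (h12 : m₁ ≤ m₂) (h23 : m₂ ≤ m₃)
    (hperm : ({m₁, m₂, m₃} : Multiset ℕ) = {a, u, v})
    (lam : ℝ) (hlam : lam = n * (∑ k, ∑ j, ∑ i, (α k j i) ^ 2) / σ2) :
    lam ≥ n / 2 * (δ ^ 2 / σ2)
      * ((m₂ : ℝ) * (m₃ : ℝ) / (((m₂ : ℝ) - 1) * ((m₃ : ℝ) - 1))) := by
  have hm1 : 2 ≤ m₁ := by rcases perm_cases _ _ _ _ _ _ hperm with h | h | h | h | h | h <;> omega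
  have hm2 : 2 ≤ m₂ := hm1.trans h12
  have hm3 : 2 ≤ m₃ := hm2.trans h23
  have b12 := mono_bd hm1 hm2 h12 h23
  have b13 := mono_bd hm1 hm3 h12 le_rfl
  have bounds : (1 - 1 / (u : ℝ)) * (1 - 1 / (v : ℝ)) ≤ (1 - 1 / (m₂ : ℝ)) * (1 - 1 / (m₃ : ℝ)) ∧
      (1 - 1 / (u : ℝ)) * (1 - 1 / (a : ℝ)) ≤ (1 - 1 / (m₂ : ℝ)) * (1 - 1 / (m₃ : ℝ)) ∧
      (1 - 1 / (v : ℝ)) * (1 - 1 / (a : ℝ)) ≤ (1 - 1 / (m₂ : ℝ)) * (1 - 1 / (m₃ : ℝ)) := by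
    rcases perm_cases _ _ _ _ _ _ hperm with h | h | h | h | h | h <;>
    · obtain ⟨e1, e2, e3⟩ := h
      rw [e1, e2, e3]
      refine ⟨?_, ?_, ?_⟩ <;> linarith
  obtain ⟨p, -, hp⟩ := Finset.exists_mem_eq_sup' (Finset.univ_nonempty_iff.mpr
    ⟨(⟨0, by omega⟩, ⟨0, by omega⟩, ⟨0, by omega⟩)⟩)
    (fun p : Fin u × Fin v × Fin a => α p.1 p.2.1 p.2.2)
  obtain ⟨q, -, hq⟩ := Finset.exists_mem_eq_inf' (Finset.univ_nonempty_iff.mpr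
    ⟨(⟨0, by omega⟩, ⟨0, by omega⟩, ⟨0, by omega⟩)⟩)
    (fun p : Fin u × Fin v × Fin a => α p.1 p.2.1 p.2.2)
  have main := main_bd hu hv ha α h1 h2 h3 p q _ bounds.1 bounds.2.1 bounds.2.2
  rw [hp, hq] at hδ
  rw [← hδ] at main
  rw [hlam, ge_iff_le]
  generalize (∑ k, ∑ j, ∑ i, (α k j i) ^ 2) = S at main
  have g2 : (2 : ℝ) ≤ m₂ := by exact_mod_cast hm2
  have g3 : (2 : ℝ) ≤ m₃ := by exact_mod_cast hm3
  have p2 : (0 : ℝ) < (m₂ : ℝ) - 1 := by linarith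
  have p3 : (0 : ℝ) < (m₃ : ℝ) - 1 := by linarith
  have hS : δ ^ 2 / 2 * ((m₂ : ℝ) * (m₃ : ℝ) / (((m₂ : ℝ) - 1) * ((m₃ : ℝ) - 1))) ≤ S := by
    have hK : 0 ≤ (m₂ : ℝ) * (m₃ : ℝ) / (((m₂ : ℝ) - 1) * ((m₃ : ℝ) - 1)) := by positivity
    have := mul_le_mul_of_nonneg_right main hK
    have e : 2 * ((1 - 1 / (m₂ : ℝ)) * (1 - 1 / (m₃ : ℝ))) * S *
        ((m₂ : ℝ) * (m₃ : ℝ) / (((m₂ : ℝ) - 1) * ((m₃ : ℝ) - 1))) = 2 * S := by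
      have : (m₂ : ℝ) ≠ 0 := by positivity
      have : (m₃ : ℝ) ≠ 0 := by positivity
      have := p2.ne'
      have := p3.ne'
      field_simp
    rw [e] at this
    linarith
  have hnσ : 0 ≤ n / σ2 := by positivity
  calc _ = n / σ2 * (δ ^ 2 / 2 * ((m₂ : ℝ) * (m₃ : ℝ) / (((m₂ : ℝ) - 1) * ((m₃ : ℝ) - 1)))) := by
        ring
    _ ≤ n / σ2 * S := mul_le_mul_of_nonneg_left hS hnσ
    _ = _ := by ring
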